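/- Let n ≥ 2 and let w satisfy the 2-dimensional recurrence with coefficients a, b, c. Then for every d with n+1 ≤ d ≤ 2n−1, the diagonal vector x_d ∈ ℝ^n satisfies x_d = h_d x_{d−1} + k_d, where x_{d−1}, h_d, k_d are given by the diagonal reduction for the upper-triangular range of diagonals. -/

import Mathlib

/-- The diagonal vector `x_d ∈ ℝ^n` of the reduction: for `1 ≤ d ≤ n`,
`(x_d)_i = w(1+i, d−i)` for `0 ≤ i ≤ d−1` and `0` otherwise; for
`n+1 ≤ d ≤ 2n−1`, `(x_d)_i = w((d+1−n)+i, n−i)` for `0 ≤ i ≤ 2n−d−1` and `0` otherwise. -/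
def xvec (n : ℕ) (w : ℕ → ℕ → ℝ) (d : ℕ) : Fin n → ℝ := fun i =>
  if d ≤ n then
    if i.val < d then w (1 + i.val) (d - i.val) else 0
  else
    if i.val < 2 * n - d then w (d + 1 - n + i.val) (n - i.val) else 0

/-- The constant vector `k_d ∈ ℝ^n` of the reduction. -/
def kvec (n : ℕ) (a b c : ℕ → ℕ → ℝ) (d : ℕ) : Fin n → ℝ := fun i =>
  if d ≤ n then
    if d = 1 then
      if i.val = 0 then c 1 1 + a 1 1 * c 0 1 + b 1 1 * c 1 0 else 0
    else
      if i.val = 0 then c 1 d + a 1 d * c 0 d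
      else if i.val = d - 1 then c d 1 + b d 1 * c d 0
      else if i.val < d then c (1 + i.val) (d - i.val)
      else 0
  else
    if i.val < 2 * n - d then c (d + 1 - n + i.val) (n - i.val) else 0

/-- The reduction matrix `h_d ∈ ℝ^{n×n}`: lower-bidiagonal for `2 ≤ d ≤ n`,
upper-bidiagonal for `n+1 ≤ d ≤ 2n−1`. -/
def hmat (n : ℕ) (a b : ℕ → ℕ → ℝ) (d : ℕ) : Matrix (Fin n) (Fin n) ℝ := fun i j =>
  if d ≤ n then
    if i.val = 0 then
      if j.val = 0 then b 1 d else 0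
    else if i.val = d - 1 then
      if j.val = d - 2 then a d 1 else 0
    else if i.val ≤ d - 2 then
      if j.val = i.val - 1 then a (1 + i.val) (d - i.val)
      else if j.val = i.val then b (1 + i.val) (d - i.val)
      else 0
    else 0
  else
    if i.val < 2 * n - d then
      if j.val = i.val then a (d + 1 - n + i.val) (n - i.val)
      else if j.val = i.val + 1 then b (d + 1 - n + i.val) (n - i.val)
      else 0
    else 0

/-- The uniform formula for `x_d` on the range `n ≤ d`, where the two cases of the definition
agree at `d = n`. -/
theorem xvec_apply_of_lt {n d : ℕ} (w : ℕ → ℕ → ℝ) (hd : n ≤ d) (i : Fin n)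
    (hi : i.val < 2 * n - d) :
    xvec n w d i = w (d + 1 - n + i.val) (n - i.val) := by
  rcases hd.eq_or_lt with rfl | hd
  · simp [xvec]
  · simp [xvec, hd.not_ge, hi]

/-- A row of `h_d` in the upper-triangular range, applied to a vector. -/
theorem hmat_mulVec_of_lt {n d : ℕ} (a b : ℕ → ℕ → ℝ) (v : Fin n → ℝ) (hd : n < d)
    (i j : Fin n) (hi : i.val < 2 * n - d) (hj : j.val = i.val + 1) :
    (hmat n a b d).mulVec v i =
      a (d + 1 - n + i.val) (n - i.val) * v i + b (d + 1 - n + i.val) (n - i.val) * v j := by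
  have hij : i ≠ j := fun h => by rw [h] at hj; omega
  rw [Matrix.mulVec, dotProduct, Fintype.sum_eq_add i j hij]
  · simp [hmat, hd.not_ge, hi, hj]
  · rintro l ⟨hli, hlj⟩
    have h1 : l.val ≠ i.val := fun h => hli (Fin.ext h)
    have h2 : l.val ≠ i.val + 1 := fun h => hlj (Fin.ext (h.trans hj.symm))
    simp [hmat, hd.not_ge, hi, h1, h2]

/-- For `n+1 ≤ d ≤ 2n−1` (upper-triangular range of diagonals),
`x_d = h_d x_{d−1} + k_d`. -/
theorem diag_recurrence_upper_range
    (n : ℕ) (hn : 2 ≤ n) (a b c w : ℕ → ℕ → ℝ)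
    (hrec : ∀ i j : ℕ, 1 ≤ i → i ≤ n → 1 ≤ j → j ≤ n →
      w i j = a i j * w (i - 1) j + b i j * w i (j - 1) + c i j)
    (hbd1 : ∀ j : ℕ, 1 ≤ j → j ≤ n → w 0 j = c 0 j)
    (hbd2 : ∀ i : ℕ, 1 ≤ i → i ≤ n → w i 0 = c i 0) :
    ∀ d : ℕ, n + 1 ≤ d → d ≤ 2 * n - 1 →
      xvec n w d = (hmat n a b d).mulVec (xvec n w (d - 1)) + kvec n a b c d := by
  intro d hd hd'
  have hnd : n < d := hd
  ext i
  by_cases hi : i.val < 2 * n - d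
  · have hj : i.val + 1 < n := by omega
    rw [Pi.add_apply, hmat_mulVec_of_lt a b _ hnd i ⟨i.val + 1, hj⟩ hi rfl,
      xvec_apply_of_lt w hnd.le i hi, xvec_apply_of_lt w (by omega) i (by omega),
      xvec_apply_of_lt w (by omega) ⟨i.val + 1, hj⟩ (by simp only; omega),
      hrec _ _ (by omega) (by omega) (by omega) (by omega)]
    have h1 : d + 1 - n + i.val - 1 = d - 1 + 1 - n + i.val := by omega
    have h2 : d - 1 + 1 - n + (i.val + 1) = d + 1 - n + i.val := by omega
    have h3 : n - (i.val + 1) = n - i.val - 1 := by omega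
    simp only [kvec, hnd.not_ge, hi, if_true, if_false, h1, h2, h3]
  · simp [xvec, hmat, kvec, Matrix.mulVec, dotProduct, hnd.not_ge, hi]
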